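/- arXiv:2605.12801 — 6 statements merged into one kernel-verified Lean document; each statement's English description precedes it below -/
import Mathlib

section
/- Let T be a real symmetric m×m matrix with eigendecomposition T = Q Λ Qᵀ, where Q is an orthogonal m×m matrix and Λ = diag(λ_1, …, λ_m). Let p : ℝ → ℝ be a polynomial, let c = Qᵀ e₁ (where e₁ is the first standard basis vector of ℝ^m), let F be the divided-difference matrix of p at λ_1, …, λ_m, let α be a real number, and set G = α · Q ((c cᵀ) ∘ F) Qᵀ, where ∘ denotes the entrywise (Hadamard) product. Then for every real symmetric m×m matrix E, the scalar function ε ↦ α · e₁ᵀ p(T + εE) e₁, where p is applied to the matrix T + εE as a matrix polynomial, is differentiable at ε = 0 with derivative equal to tr(Gᵀ E). -/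
open Matrix Polynomial

/-- First divided difference. -/
noncomputable def ddiff (p : Polynomial ℝ) (x y : ℝ) : ℝ :=
  if x = y then (Polynomial.derivative p).eval x else (p.eval x - p.eval y) / (x - y)

theorem ddiff_add (p q : Polynomial ℝ) (x y : ℝ) :
    ddiff (p + q) x y = ddiff p x y + ddiff q x y := by
  unfold ddiff
  split_ifs with h
  · simp
  · simp only [eval_add]; ring

theorem ddiff_X_mul (q : Polynomial ℝ) (x y : ℝ) :
    ddiff (X * q) x y = x * ddiff q x y + q.eval y := by
  unfold ddiff
  split_ifs with h
  · subst h; simp; ring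
  · have : x - y ≠ 0 := sub_ne_zero.mpr h
    simp only [eval_mul, eval_X]; field_simp; ring

theorem aeval_diagonal_real {m : ℕ} (lam : Fin m → ℝ) (q : Polynomial ℝ) :
    aeval (Matrix.diagonal lam) q = Matrix.diagonal (fun i => q.eval (lam i)) := by
  induction q using Polynomial.induction_on with
  | C a => simp [Matrix.algebraMap_eq_diagonal]
  | add p q hp hq => simp [hp, hq]
  | monomial n a h =>
    rw [pow_succ, ← mul_assoc, map_mul, h, aeval_X, Matrix.diagonal_mul_diagonal]
    simp

theorem hasDerivAt_entry {m : ℕ} (lam : Fin m → ℝ) (A : Matrix (Fin m) (Fin m) ℝ)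
    (p : Polynomial ℝ) : ∀ i j, HasDerivAt
      (fun ε : ℝ => (aeval (Matrix.diagonal lam + ε • A) p) i j)
      (ddiff p (lam i) (lam j) * A i j) 0 := by
  induction p using Polynomial.induction_on with
  | C a =>
    intro i j
    have : ddiff (C a) (lam i) (lam j) = 0 := by unfold ddiff; simp
    rw [this, zero_mul]
    simp only [aeval_C]
    exact hasDerivAt_const _ _
  | add p q hp hq =>
    intro i j
    simp only [map_add, Matrix.add_apply, ddiff_add, add_mul]
    exact (hp i j).add (hq i j)
  | monomial n a h =>
    intro i j
    have e : (C a * X ^ (n + 1) : Polynomial ℝ) = X * (C a * X ^ n) := by ring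
    rw [e, ddiff_X_mul]
    generalize (C a * X ^ n : Polynomial ℝ) = q at h
    simp only [map_mul, aeval_X, Matrix.mul_apply]
    have h1 : ∀ k, HasDerivAt (fun ε : ℝ => (Matrix.diagonal lam + ε • A) i k) (A i k) 0 := by
      intro k
      simp only [Matrix.add_apply, Matrix.smul_apply, smul_eq_mul]
      simpa using ((hasDerivAt_id (0 : ℝ)).mul_const (A i k)).const_add (Matrix.diagonal lam i k)
    have h2 := HasDerivAt.fun_sum (u := Finset.univ) (fun k _ => (h1 k).mul (h k j))
    refine h2.congr_deriv ?_
    simp only [zero_smul, add_zero, aeval_diagonal_real]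
    rw [Finset.sum_add_distrib]
    simp [Matrix.diagonal_apply]
    ring

theorem aeval_conj_orth {m : ℕ} (Q B : Matrix (Fin m) (Fin m) ℝ) (hQ : Qᵀ * Q = 1)
    (p : Polynomial ℝ) : aeval (Q * B * Qᵀ) p = Q * aeval B p * Qᵀ := by
  have hQ' : Q * Qᵀ = 1 := mul_eq_one_comm.mp hQ
  induction p using Polynomial.induction_on with
  | C a => simp [Algebra.algebraMap_eq_smul_one, hQ']
  | add p q hp hq => simp [hp, hq, mul_add, add_mul]
  | monomial n a h =>
    rw [pow_succ, ← mul_assoc, map_mul, h, aeval_X, map_mul _ (C a * X ^ n), aeval_X]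
    calc _ = Q * (aeval B) (C a * X ^ n) * (Qᵀ * Q) * B * Qᵀ := by simp only [mul_assoc]
      _ = _ := by rw [hQ]; simp only [mul_assoc, one_mul]

/-- Theorem 3.1 (projected sensitivity), for polynomial `p`: with
`T = Q Λ Qᵀ` symmetric (`Q` orthogonal, `Λ = diag(λ)`), `c = Qᵀ e₁`,
`F` the divided-difference matrix of `p` at `λ₁, …, λ_m`, and
`G = α Q ((c cᵀ) ∘ F) Qᵀ`, for every symmetric `E` the scalar map
`ε ↦ α e₁ᵀ p(T + ε E) e₁` is differentiable at `ε = 0` with derivative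
`tr(Gᵀ E)`. -/
theorem projected_sensitivity_polynomial (m : ℕ) (hm : 0 < m)
    (T Q : Matrix (Fin m) (Fin m) ℝ) (lam : Fin m → ℝ)
    (hTsymm : T.IsSymm) (hQ : Qᵀ * Q = 1)
    (hT : T = Q * Matrix.diagonal lam * Qᵀ)
    (p : Polynomial ℝ) (α : ℝ)
    (c : Fin m → ℝ) (hc : c = Qᵀ.mulVec (Pi.single (⟨0, hm⟩ : Fin m) 1))
    (F : Matrix (Fin m) (Fin m) ℝ)
    (hF : ∀ i j, F i j =
      if lam i = lam j then (Polynomial.derivative p).eval (lam i)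
      else (p.eval (lam i) - p.eval (lam j)) / (lam i - lam j))
    (G : Matrix (Fin m) (Fin m) ℝ)
    (hG : G = α • (Q * (Matrix.vecMulVec c c ⊙ F) * Qᵀ)) :
    ∀ E : Matrix (Fin m) (Fin m) ℝ, E.IsSymm →
      HasDerivAt
        (fun ε : ℝ => α *
          ((Pi.single (⟨0, hm⟩ : Fin m) 1 : Fin m → ℝ) ⬝ᵥ
            ((Polynomial.aeval (T + ε • E)) p).mulVec (Pi.single (⟨0, hm⟩ : Fin m) 1)))
        (Matrix.trace (Gᵀ * E)) 0 := by
  intro E _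
  have hQ' : Q * Qᵀ = 1 := mul_eq_one_comm.mp hQ
  have hTE : ∀ ε : ℝ, T + ε • E = Q * (Matrix.diagonal lam + ε • (Qᵀ * E * Q)) * Qᵀ := by
    intro ε
    have : Q * (Qᵀ * E * Q) * Qᵀ = E := by
      calc _ = (Q * Qᵀ) * E * (Q * Qᵀ) := by simp only [mul_assoc]
        _ = E := by rw [hQ']; simp
    rw [mul_add, add_mul, ← hT, Matrix.mul_smul, Matrix.smul_mul, this]
  have hfun : ∀ ε : ℝ, ((Pi.single (⟨0, hm⟩ : Fin m) 1 : Fin m → ℝ) ⬝ᵥ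
      ((Polynomial.aeval (T + ε • E)) p).mulVec (Pi.single (⟨0, hm⟩ : Fin m) 1))
      = ∑ i, ∑ j, c i * c j *
        (aeval (Matrix.diagonal lam + ε • (Qᵀ * E * Q)) p) i j := by
    intro ε
    rw [hTE, aeval_conj_orth _ _ hQ, ← Matrix.mulVec_mulVec, ← hc, ← Matrix.mulVec_mulVec,
      Matrix.dotProduct_mulVec, ← Matrix.mulVec_transpose, ← hc]
    simp only [dotProduct, Matrix.mulVec, Finset.mul_sum]
    refine Finset.sum_congr rfl fun i _ => Finset.sum_congr rfl fun j _ => ?_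
    ring
  simp only [hfun]
  have hd := (HasDerivAt.fun_sum (u := Finset.univ) (fun i _ =>
    HasDerivAt.fun_sum (u := Finset.univ) (fun j _ =>
      (hasDerivAt_entry lam (Qᵀ * E * Q) p i j).const_mul (c i * c j)))).const_mul α
  refine hd.congr_deriv ?_
  have hF' : ∀ i j, ddiff p (lam i) (lam j) = F i j := fun i j => (hF i j).symm
  have htr : Matrix.trace (Gᵀ * E)
      = α * Matrix.trace ((Matrix.vecMulVec c c ⊙ F)ᵀ * (Qᵀ * E * Q)) := by
    rw [hG, Matrix.transpose_smul, Matrix.smul_mul, Matrix.trace_smul, smul_eq_mul,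
      Matrix.transpose_mul, Matrix.transpose_mul, Matrix.transpose_transpose, mul_assoc,
      Matrix.trace_mul_comm]
    simp only [mul_assoc]
  rw [htr]
  congr 1
  simp only [Matrix.trace, Matrix.diag_apply, Matrix.mul_apply (M := (Matrix.vecMulVec c c ⊙ F)ᵀ),
    Matrix.transpose_apply (Matrix.vecMulVec c c ⊙ F), Matrix.hadamard_apply,
    Matrix.vecMulVec_apply, hF']
  rw [Finset.sum_comm]
  refine Finset.sum_congr rfl fun i _ => Finset.sum_congr rfl fun j _ => ?_
  ring
end

section
/- Let A ∈ ℝ^{n×n} be symmetric, T ∈ ℝ^{m×m} be symmetric, V ∈ ℝ^{n×m} with Vᵀ V = I_m, W ∈ ℝ^{n×(n−m)} with Wᵀ W = I_{n−m} and Wᵀ V = 0, β ∈ ℝ, and let w = W e₁^{(n−m)} be the first column of W. Suppose the Lanczos relation A V = V T + β w e_mᵀ holds, where e_m is the m-th standard basis vector of ℝ^m. Let dA ∈ ℝ^{n×n} be symmetric, let S ∈ ℝ^{m×m} be skew-symmetric (Sᵀ = −S), let N ∈ ℝ^{(n−m)×m}, set dV = V S + W N and η = Nᵀ e₁^{(n−m)}.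 Then dVᵀ A V + Vᵀ dA V + Vᵀ A dV = Vᵀ dA V + (T S − S T) + β (η e_mᵀ + e_m ηᵀ). -/
open Matrix

/-- Lemma A.1 (differential of the tridiagonal matrix): with `A`, `T`, `dA`
symmetric, under the Lanczos relation `A V = V T + β w e_mᵀ` (with `w` the
first column of `W`), for skew-symmetric `S`, `dV = V S + W N` and `η = Nᵀ e₁`,
`dVᵀ A V + Vᵀ dA V + Vᵀ A dV = Vᵀ dA V + (T S − S T) + β (η e_mᵀ + e_m ηᵀ)`. -/
theorem dT_decomposition (n m : ℕ) (hm : 0 < m) (hmn : m < n)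
    (A : Matrix (Fin n) (Fin n) ℝ) (hA : A.IsSymm)
    (T : Matrix (Fin m) (Fin m) ℝ) (hT : T.IsSymm)
    (V : Matrix (Fin n) (Fin m) ℝ) (hV : Vᵀ * V = 1)
    (W : Matrix (Fin n) (Fin (n - m)) ℝ) (hW : Wᵀ * W = 1) (hWV : Wᵀ * V = 0)
    (β : ℝ)
    (hLanczos : A * V = V * T + β •
      Matrix.vecMulVec (W.mulVec (Pi.single (⟨0, Nat.sub_pos_of_lt hmn⟩ : Fin (n - m)) 1))
        (Pi.single (⟨m - 1, by omega⟩ : Fin m) 1))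
    (dA : Matrix (Fin n) (Fin n) ℝ) (hdA : dA.IsSymm)
    (S : Matrix (Fin m) (Fin m) ℝ) (hS : Sᵀ = -S)
    (N : Matrix (Fin (n - m)) (Fin m) ℝ)
    (dV : Matrix (Fin n) (Fin m) ℝ) (hdV : dV = V * S + W * N)
    (η : Fin m → ℝ)
    (hη : η = Nᵀ.mulVec (Pi.single (⟨0, Nat.sub_pos_of_lt hmn⟩ : Fin (n - m)) 1)) :
    dVᵀ * A * V + Vᵀ * dA * V + Vᵀ * A * dV =
      Vᵀ * dA * V + (T * S - S * T) + β •
        (Matrix.vecMulVec η (Pi.single (⟨m - 1, by omega⟩ : Fin m) 1) +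
         Matrix.vecMulVec (Pi.single (⟨m - 1, by omega⟩ : Fin m) 1) η) := by
  have hVW : Vᵀ * W = 0 := by
    have h := congrArg Matrix.transpose hWV
    simpa [Matrix.transpose_mul] using h
  have h1 : dVᵀ * V = -S := by
    rw [hdV, Matrix.transpose_add, Matrix.transpose_mul, Matrix.transpose_mul, Matrix.add_mul,
      Matrix.mul_assoc, Matrix.mul_assoc, hV, hWV, hS]
    simp
  have h2 : dVᵀ * W = Nᵀ := by
    rw [hdV, Matrix.transpose_add, Matrix.transpose_mul, Matrix.transpose_mul, Matrix.add_mul,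
      Matrix.mul_assoc, Matrix.mul_assoc, hVW, hW]
    simp
  have hX : dVᵀ * A * V = -(S * T) + β •
      Matrix.vecMulVec η (Pi.single (⟨m - 1, by omega⟩ : Fin m) 1) := by
    rw [Matrix.mul_assoc, hLanczos, Matrix.mul_add, ← Matrix.mul_assoc, h1, Matrix.mul_smul,
      Matrix.mul_vecMulVec, Matrix.mulVec_mulVec, h2, ← hη, Matrix.neg_mul]
  have hY : Vᵀ * A * dV = T * S + β •
      Matrix.vecMulVec (Pi.single (⟨m - 1, by omega⟩ : Fin m) 1) η := by
    have h := congrArg Matrix.transpose hX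
    rw [Matrix.transpose_mul, Matrix.transpose_mul, Matrix.transpose_transpose, hA.eq,
      Matrix.transpose_add, Matrix.transpose_neg, Matrix.transpose_mul, hT.eq, hS,
      Matrix.transpose_smul, Matrix.transpose_vecMulVec, Matrix.mul_neg, neg_neg,
      ← Matrix.mul_assoc] at h
    exact h
  rw [hX, hY, smul_add]
  abel
end

section
/- Let Λ = diag(λ_1, …, λ_m) be a real diagonal m×m matrix, Q ∈ ℝ^{m×m} orthogonal, T = Q Λ Qᵀ, and c = Qᵀ e₁ where e₁ is the first standard basis vector of ℝ^m. Let f : ℝ → ℝ be a function and let F ∈ ℝ^{m×m} be a symmetric matrix satisfying F_{ij} (λ_j − λ_i) = f(λ_j) − f(λ_i) for all i, j. Let α ∈ ℝ and G = α · Q ((c cᵀ) ∘ F) Qᵀ, where ∘ denotes the entrywise (Hadamard) product. If S ∈ ℝ^{m×m} is skew-symmetric (Sᵀ = −S) and S e₁ = 0, then tr(Gᵀ (T S − S T)) = 0. -/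
open Matrix

/-- Lemma A.2 (vanishing commutator): with `T = Q Λ Qᵀ`, `c = Qᵀ e₁`,
`F` a symmetric divided-difference matrix of `f` at the eigenvalues, and
`G = α Q ((c cᵀ) ∘ F) Qᵀ`, if `S` is skew-symmetric with `S e₁ = 0` then
`tr(Gᵀ (T S − S T)) = 0`. -/
theorem vanishing_commutator (m : ℕ) (hm : 0 < m) (lam : Fin m → ℝ)
    (Q : Matrix (Fin m) (Fin m) ℝ) (hQ : Qᵀ * Q = 1)
    (T : Matrix (Fin m) (Fin m) ℝ) (hT : T = Q * Matrix.diagonal lam * Qᵀ)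
    (c : Fin m → ℝ) (hc : c = Qᵀ.mulVec (Pi.single (⟨0, hm⟩ : Fin m) 1))
    (f : ℝ → ℝ) (F : Matrix (Fin m) (Fin m) ℝ) (hFsymm : F.IsSymm)
    (hF : ∀ i j, F i j * (lam j - lam i) = f (lam j) - f (lam i))
    (α : ℝ) (G : Matrix (Fin m) (Fin m) ℝ)
    (hG : G = α • (Q * (Matrix.vecMulVec c c ⊙ F) * Qᵀ))
    (S : Matrix (Fin m) (Fin m) ℝ) (hS : Sᵀ = -S)
    (hSe : S.mulVec (Pi.single (⟨0, hm⟩ : Fin m) 1) = 0) :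
    Matrix.trace (Gᵀ * (T * S - S * T)) = 0 := by
  have hQ' : Q * Qᵀ = 1 := mul_eq_one_comm.mp hQ
  set M := Matrix.vecMulVec c c ⊙ F with hM
  have hMs : Mᵀ = M := by
    ext i j
    simp only [hM, Matrix.transpose_apply, Matrix.hadamard_apply, Matrix.vecMulVec_apply]
    rw [hFsymm.apply i j]
    ring
  obtain ⟨K, hK⟩ : ∃ K, K = Qᵀ * S * Q := ⟨_, rfl⟩
  have hKc : K.mulVec c = 0 := by
    rw [hK, hc, Matrix.mulVec_mulVec, Matrix.mul_assoc, hQ', Matrix.mul_one,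
      ← Matrix.mulVec_mulVec, hSe, Matrix.mulVec_zero]
  have hKs : Kᵀ = -K := by
    rw [hK]
    simp [Matrix.transpose_mul, hS, Matrix.mul_assoc]
  have h1 : ∀ i, ∑ j, K i j * c j = 0 := fun i => congrFun hKc i
  have h3 : ∀ i, ∑ j, K j i * c j = 0 := by
    intro i
    have h : ∀ j, K j i = - K i j := fun j => congrFun (congrFun hKs i) j
    simp only [h, neg_mul, Finset.sum_neg_distrib, h1, neg_zero]
  have e1 : Gᵀ * (T * S - S * T) =
      α • (Q * (M * (Matrix.diagonal lam * (Qᵀ * S)) - M * (K * (Matrix.diagonal lam * Qᵀ)))) := by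
    rw [hG, hT, hK, Matrix.transpose_smul, Matrix.transpose_mul, Matrix.transpose_mul, hMs,
      Matrix.transpose_transpose, Matrix.smul_mul]
    congr 1
    simp only [Matrix.mul_sub, Matrix.mul_assoc]
    rw [← Matrix.mul_assoc Qᵀ Q, hQ, Matrix.one_mul]
  rw [e1, Matrix.trace_smul, Matrix.trace_mul_comm, Matrix.sub_mul]
  have e2 : M * (Matrix.diagonal lam * (Qᵀ * S)) * Q - M * (K * (Matrix.diagonal lam * Qᵀ)) * Q
      = M * (Matrix.diagonal lam * K - K * Matrix.diagonal lam) := by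
    rw [hK]
    simp only [Matrix.mul_sub, Matrix.mul_assoc, hQ, Matrix.mul_one]
  rw [e2]
  have e3 : Matrix.trace (M * (Matrix.diagonal lam * K - K * Matrix.diagonal lam)) =
      ∑ i, ∑ j, (c i * (f (lam j) * c j) * K j i - c i * f (lam i) * (K j i * c j)) := by
    simp only [Matrix.trace, Matrix.diag_apply, Matrix.mul_apply (M := M)]
    refine Finset.sum_congr rfl fun i _ => Finset.sum_congr rfl fun j _ => ?_
    simp only [hM, Matrix.hadamard_apply, Matrix.vecMulVec_apply, Matrix.sub_apply,
      Matrix.diagonal_mul, Matrix.mul_diagonal]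
    linear_combination (c i * c j * K j i) * hF i j
  have e4 : ∑ i, ∑ j, c i * (f (lam j) * c j) * K j i = 0 := by
    rw [Finset.sum_comm]
    refine Finset.sum_eq_zero fun j _ => ?_
    have : ∀ i, c i * (f (lam j) * c j) * K j i = (f (lam j) * c j) * (K j i * c i) :=
      fun i => by ring
    simp only [this, ← Finset.mul_sum, h1, mul_zero]
  rw [e3]
  simp only [Finset.sum_sub_distrib, e4, ← Finset.mul_sum, h3]
  simp
end

section
/- Let Λ = diag(λ_1, …, λ_m) be a real diagonal m×m matrix, c ∈ ℝ^m, f : ℝ → ℝ a function, and F ∈ ℝ^{m×m} a matrix satisfying F_{ij} (λ_j − λ_i) = f(λ_j) − f(λ_i) for all i, j. Write f(Λ) = diag(f(λ_1), …, f(λ_m)). Then for every skew-symmetric S̃ ∈ ℝ^{m×m} (S̃ᵀ = −S̃), tr( ((c cᵀ) ∘ F) (Λ S̃ − S̃ Λ) ) = 2 (f(Λ) c)ᵀ S̃ c, where ∘ denotes the entrywise (Hadamard) product. -/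
open Matrix

/-- Key computation of Lemma A.2: for a diagonal `Λ = diag(λ)`, `c ∈ ℝ^m`,
a divided-difference matrix `F` of `f` (i.e. `F i j (λ j − λ i) = f (λ j) − f (λ i)`),
and skew-symmetric `S̃`, the commutator trace collapses:
`tr(((c cᵀ) ∘ F)(Λ S̃ − S̃ Λ)) = 2 (f(Λ) c)ᵀ S̃ c`. -/
theorem commutator_trace_collapse (m : ℕ) (lam c : Fin m → ℝ) (f : ℝ → ℝ)
    (F : Matrix (Fin m) (Fin m) ℝ)
    (hF : ∀ i j, F i j * (lam j - lam i) = f (lam j) - f (lam i))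
    (St : Matrix (Fin m) (Fin m) ℝ) (hSt : Stᵀ = -St) :
    Matrix.trace ((Matrix.vecMulVec c c ⊙ F) *
        (Matrix.diagonal lam * St - St * Matrix.diagonal lam)) =
      2 * ((Matrix.diagonal (fun i => f (lam i))).mulVec c ⬝ᵥ St.mulVec c) := by
  have hS : ∀ i j, St j i = - St i j := fun i j => by
    have h := congrFun (congrFun hSt i) j
    simpa using h
  have hL : Matrix.trace ((Matrix.vecMulVec c c ⊙ F) *
        (Matrix.diagonal lam * St - St * Matrix.diagonal lam)) =
      (∑ i, ∑ j, f (lam j) * c j * (St j i * c i)) +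
        ∑ i, ∑ j, f (lam i) * c i * (St i j * c j) := by
    rw [← Finset.sum_add_distrib]
    simp only [Matrix.trace, Matrix.diag_apply, Matrix.mul_apply (M := _ ⊙ _)]
    refine Finset.sum_congr rfl fun i _ => ?_
    rw [← Finset.sum_add_distrib]
    refine Finset.sum_congr rfl fun j _ => ?_
    simp only [Matrix.hadamard_apply, Matrix.vecMulVec_apply, Matrix.sub_apply,
      Matrix.diagonal_mul, Matrix.mul_diagonal]
    rw [hS i j]
    linear_combination (-(c i * c j * St i j)) * hF i j
  have hR : (Matrix.diagonal (fun i => f (lam i))).mulVec c ⬝ᵥ St.mulVec c =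
      ∑ i, ∑ j, f (lam i) * c i * (St i j * c j) := by
    simp only [dotProduct, Matrix.mulVec_diagonal]
    refine Finset.sum_congr rfl fun i _ => ?_
    simp only [Matrix.mulVec, dotProduct, Finset.mul_sum]
  rw [hL, hR, Finset.sum_comm]
  ring
end

section
/- Let A ∈ ℝ^{n×n} be symmetric, V ∈ ℝ^{n×m} with Vᵀ V = I_m, W ∈ ℝ^{n×(n−m)} with Wᵀ W = I_{n−m} and Wᵀ V = 0, β ∈ ℝ, and let w = W e₁^{(n−m)} be the first column of W. Let T ∈ ℝ^{m×m} satisfy the Lanczos relation A V = V T + β w e_mᵀ and admit an eigendecomposition T = Q Λ Qᵀ with Q orthogonal and Λ = diag(λ_1, …, λ_m); set c = Qᵀ e₁. Let f : ℝ → ℝ be a function and F ∈ ℝ^{m×m} a symmetric matrix with F_{ij}(λ_j − λ_i) = f(λ_j) − f(λ_i) for all i, j; let α ∈ ℝ and G = α · Q ((c cᵀ) ∘ F) Qᵀ. Let dA ∈ ℝ^{n×n} be symmetric, S ∈ ℝ^{m×m} skew-symmetric with S e₁ = 0, N ∈ ℝ^{(n−m)×m}, dV = V S + W N, η = Nᵀ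 e₁^{(n−m)}, and dT = dVᵀ A V + Vᵀ dA V + Vᵀ A dV. Then tr(Gᵀ dT) = tr(V G Vᵀ dA) + 2 β e_mᵀ G η. -/
open Matrix

theorem aux_sum {m : ℕ} (P F : Matrix (Fin m) (Fin m) ℝ) (lam c : Fin m → ℝ) (f : ℝ → ℝ)
    (hP : ∀ i j, P i j = - P j i) (hPc : ∀ i, ∑ j, P i j * c j = 0)
    (hFs : ∀ i j, F i j = F j i)
    (hF : ∀ i j, F i j * (lam j - lam i) = f (lam j) - f (lam i)) :
    ∑ i, ∑ j, c i * c j * F i j * P j i * lam i = 0 := by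
  have h1 : ∑ i, ∑ j, c i * c j * F i j * P j i * lam i
      = - ∑ i, ∑ j, c i * c j * F i j * P j i * lam j := by
    rw [Finset.sum_comm, ← Finset.sum_neg_distrib]
    refine Finset.sum_congr rfl fun i _ => ?_
    rw [← Finset.sum_neg_distrib]
    refine Finset.sum_congr rfl fun j _ => ?_
    rw [hP i j, hFs j i]; ring
  have h2 : ∑ i, ∑ j, c i * c j * F i j * P j i * lam i
      - ∑ i, ∑ j, c i * c j * F i j * P j i * lam j
      = ∑ i, ∑ j, c i * f (lam i) * (c j * P j i) - ∑ i, ∑ j, c i * (f (lam j) * c j * P j i) := by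
    simp only [← Finset.sum_sub_distrib]
    refine Finset.sum_congr rfl fun i _ => Finset.sum_congr rfl fun j _ => ?_
    linear_combination (-(c i * c j * P j i)) * hF i j
  have h3 : ∑ i, ∑ j, c i * f (lam i) * (c j * P j i) = 0 := by
    refine Finset.sum_eq_zero fun i _ => ?_
    rw [← Finset.mul_sum]
    have : ∑ j, c j * P j i = - ∑ j, P i j * c j := by
      rw [← Finset.sum_neg_distrib]
      refine Finset.sum_congr rfl fun j _ => ?_
      rw [hP i j]; ring
    rw [this, hPc]; simp
  have h4 : ∑ i, ∑ j, c i * (f (lam j) * c j * P j i) = 0 := by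
    rw [Finset.sum_comm]
    refine Finset.sum_eq_zero fun j _ => ?_
    have : ∑ i, c i * (f (lam j) * c j * P j i) = (f (lam j) * c j) * ∑ i, P j i * c i := by
      rw [Finset.mul_sum]
      refine Finset.sum_congr rfl fun i _ => ?_
      ring
    rw [this, hPc]; simp
  linarith

/-- Theorem 3.2 (error from ignoring basis variation): the exact differential of
the Lanczos quadratic-form estimate satisfies
`tr(Gᵀ dT) = tr(V G Vᵀ dA) + 2 β e_mᵀ G η`. -/
theorem lanczos_gradient_error_formula (n m : ℕ) (hm : 0 < m) (hmn : m < n)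
    (A : Matrix (Fin n) (Fin n) ℝ) (hA : A.IsSymm)
    (V : Matrix (Fin n) (Fin m) ℝ) (hV : Vᵀ * V = 1)
    (W : Matrix (Fin n) (Fin (n - m)) ℝ) (hW : Wᵀ * W = 1) (hWV : Wᵀ * V = 0)
    (β : ℝ) (T : Matrix (Fin m) (Fin m) ℝ)
    (hLanczos : A * V = V * T + β •
      Matrix.vecMulVec (W.mulVec (Pi.single (⟨0, Nat.sub_pos_of_lt hmn⟩ : Fin (n - m)) 1))
        (Pi.single (⟨m - 1, by omega⟩ : Fin m) 1))
    (Q : Matrix (Fin m) (Fin m) ℝ) (hQ : Qᵀ * Q = 1) (lam : Fin m → ℝ)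
    (hT : T = Q * Matrix.diagonal lam * Qᵀ)
    (c : Fin m → ℝ) (hc : c = Qᵀ.mulVec (Pi.single (⟨0, hm⟩ : Fin m) 1))
    (f : ℝ → ℝ) (F : Matrix (Fin m) (Fin m) ℝ) (hFsymm : F.IsSymm)
    (hF : ∀ i j, F i j * (lam j - lam i) = f (lam j) - f (lam i))
    (α : ℝ) (G : Matrix (Fin m) (Fin m) ℝ)
    (hG : G = α • (Q * (Matrix.vecMulVec c c ⊙ F) * Qᵀ))
    (dA : Matrix (Fin n) (Fin n) ℝ) (hdA : dA.IsSymm)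
    (S : Matrix (Fin m) (Fin m) ℝ) (hS : Sᵀ = -S)
    (hSe : S.mulVec (Pi.single (⟨0, hm⟩ : Fin m) 1) = 0)
    (N : Matrix (Fin (n - m)) (Fin m) ℝ)
    (dV : Matrix (Fin n) (Fin m) ℝ) (hdV : dV = V * S + W * N)
    (η : Fin m → ℝ)
    (hη : η = Nᵀ.mulVec (Pi.single (⟨0, Nat.sub_pos_of_lt hmn⟩ : Fin (n - m)) 1))
    (dT : Matrix (Fin m) (Fin m) ℝ)
    (hdT : dT = dVᵀ * A * V + Vᵀ * dA * V + Vᵀ * A * dV) :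
    Matrix.trace (Gᵀ * dT) =
      Matrix.trace (V * G * Vᵀ * dA) +
        2 * β * ((Pi.single (⟨m - 1, by omega⟩ : Fin m) 1 : Fin m → ℝ) ⬝ᵥ G.mulVec η) := by
  generalize hem : (Pi.single (⟨m - 1, by omega⟩ : Fin m) 1 : Fin m → ℝ) = em at *
  generalize (Pi.single (⟨0, Nat.sub_pos_of_lt hmn⟩ : Fin (n - m)) 1 : Fin (n - m) → ℝ) = e0 at *
  generalize (Pi.single (⟨0, hm⟩ : Fin m) 1 : Fin m → ℝ) = e1 at *
  have hQ' : Q * Qᵀ = 1 := mul_eq_one_comm.mp hQ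
  have hVW : Vᵀ * W = 0 := by
    have := congrArg transpose hWV
    simpa [transpose_mul] using this
  have hH : (vecMulVec c c ⊙ F)ᵀ = vecMulVec c c ⊙ F := by
    ext i j
    simp [vecMulVec_apply, hFsymm.apply i j, mul_comm]
  have hGs : Gᵀ = G := by
    rw [hG]
    simp [transpose_mul, hH, Matrix.mul_assoc]
  have hX : dVᵀ * A * V = -(S * T) + β • vecMulVec η em := by
    have e : dVᵀ = -(S * Vᵀ) + Nᵀ * Wᵀ := by
      rw [hdV]; simp [transpose_mul, hS]
    have a1 : Vᵀ * (A * V) = T := by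
      rw [hLanczos, Matrix.mul_add, ← Matrix.mul_assoc, hV, Matrix.mul_smul, mul_vecMulVec,
        mulVec_mulVec, hVW]
      simp
    have a2 : Wᵀ * (A * V) = β • vecMulVec e0 em := by
      rw [hLanczos, Matrix.mul_add, ← Matrix.mul_assoc, hWV, Matrix.mul_smul, mul_vecMulVec,
        mulVec_mulVec, hW]
      simp
    rw [e, Matrix.mul_assoc, Matrix.add_mul, Matrix.neg_mul, Matrix.mul_assoc, a1,
      Matrix.mul_assoc, a2, Matrix.mul_smul, mul_vecMulVec, hη]
  have hXt : Vᵀ * A * dV = (dVᵀ * A * V)ᵀ := by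
    simp [transpose_mul, hA.eq, Matrix.mul_assoc]
  have hz : trace (G * (S * T)) = 0 := by
    set P := Qᵀ * S * Q with hPdef
    have hPt : Pᵀ = -P := by
      rw [hPdef]; simp [transpose_mul, hS, Matrix.mul_assoc]
    have hPc : P *ᵥ c = 0 := by
      rw [hc, mulVec_mulVec, hPdef, Matrix.mul_assoc, hQ', Matrix.mul_one, ← mulVec_mulVec, hSe,
        mulVec_zero]
    have key := aux_sum P F lam c f (fun i j => by
        have := congrFun (congrFun hPt j) i
        simpa using this) (fun i => congrFun hPc i) (fun i j => hFsymm.apply j i) hF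
    have : trace (G * (S * T)) = α * trace ((vecMulVec c c ⊙ F) * (P * diagonal lam)) := by
      rw [hG, hT, Matrix.smul_mul, trace_smul, smul_eq_mul]
      congr 1
      rw [Matrix.mul_assoc, Matrix.mul_assoc, trace_mul_comm, hPdef]
      simp only [Matrix.mul_assoc, hQ, Matrix.mul_one]
    rw [this]
    have t : trace ((vecMulVec c c ⊙ F) * (P * diagonal lam))
        = ∑ i, ∑ j, c i * c j * F i j * P j i * lam i := by
      simp only [trace, diag_apply, Matrix.mul_apply (M := vecMulVec c c ⊙ F), mul_diagonal,
        hadamard_apply, vecMulVec_apply]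
      refine Finset.sum_congr rfl fun i _ => Finset.sum_congr rfl fun j _ => ?_
      ring
    rw [t, key, mul_zero]
  have hb : trace (G * (dVᵀ * A * V)) = β * (em ⬝ᵥ G *ᵥ η) := by
    rw [hX, Matrix.mul_add, trace_add, Matrix.mul_neg, trace_neg, hz, Matrix.mul_smul, trace_smul,
      mul_vecMulVec, trace_vecMulVec, dotProduct_comm]
    simp
  have hb' : trace (G * (dVᵀ * A * V)ᵀ) = trace (G * (dVᵀ * A * V)) := by
    rw [← trace_transpose, transpose_mul, transpose_transpose, hGs, trace_mul_comm]
  have hd : trace (G * (Vᵀ * dA * V)) = trace (V * G * Vᵀ * dA) := by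
    rw [← Matrix.mul_assoc, trace_mul_comm]
    simp only [Matrix.mul_assoc]
  rw [hGs, hdT, hXt, Matrix.mul_add, Matrix.mul_add, trace_add, trace_add, hb', hb, hd]
  ring
end

section
/- Under the hypotheses of the error formula for the Lanczos differential — A ∈ ℝ^{n×n} symmetric; V ∈ ℝ^{n×m} with Vᵀ V = I_m; W ∈ ℝ^{n×(n−m)} with Wᵀ W = I_{n−m}, Wᵀ V = 0, and first column w = W e₁^{(n−m)}; T ∈ ℝ^{m×m} with A V = V T + β w e_mᵀ and eigendecomposition T = Q Λ Qᵀ (Q orthogonal, Λ = diag(λ_1, …, λ_m)); c = Qᵀ e₁; F ∈ ℝ^{m×m} symmetric with F_{ij}(λ_j − λ_i) = f(λ_j) − f(λ_i) for all i, j for a function f : ℝ → ℝ; G = α · Q((c cᵀ) ∘ F)Qᵀ for α ∈ ℝ; dA ∈ ℝ^{n×n} symmetric; S skew-symmetric with S e₁ = 0; N ∈ ℝ^{(n−m)×m}; dV = V S + W N; dT = dVᵀ A V + Vᵀ dA V + Vᵀ A dV — if additionally β = 0 (the Krylov subspace is A-invariant), then tr(Gᵀ dT) = tr(V G Vᵀ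 dA); that is, the forward-only gradient approximation is exact. -/
open Matrix

/-- Consequence of Theorem 3.2: when `β = 0` (the Krylov subspace is
`A`-invariant), the forward-only gradient approximation is exact:
`tr(Gᵀ dT) = tr(V G Vᵀ dA)`. -/
theorem lanczos_gradient_exact_of_invariant (n m : ℕ) (hm : 0 < m) (hmn : m < n)
    (A : Matrix (Fin n) (Fin n) ℝ) (hA : A.IsSymm)
    (V : Matrix (Fin n) (Fin m) ℝ) (hV : Vᵀ * V = 1)
    (W : Matrix (Fin n) (Fin (n - m)) ℝ) (hW : Wᵀ * W = 1) (hWV : Wᵀ * V = 0)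
    (β : ℝ) (T : Matrix (Fin m) (Fin m) ℝ)
    (hLanczos : A * V = V * T + β •
      Matrix.vecMulVec (W.mulVec (Pi.single (⟨0, Nat.sub_pos_of_lt hmn⟩ : Fin (n - m)) 1))
        (Pi.single (⟨m - 1, by omega⟩ : Fin m) 1))
    (Q : Matrix (Fin m) (Fin m) ℝ) (hQ : Qᵀ * Q = 1) (lam : Fin m → ℝ)
    (hT : T = Q * Matrix.diagonal lam * Qᵀ)
    (c : Fin m → ℝ) (hc : c = Qᵀ.mulVec (Pi.single (⟨0, hm⟩ : Fin m) 1))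
    (f : ℝ → ℝ) (F : Matrix (Fin m) (Fin m) ℝ) (hFsymm : F.IsSymm)
    (hF : ∀ i j, F i j * (lam j - lam i) = f (lam j) - f (lam i))
    (α : ℝ) (G : Matrix (Fin m) (Fin m) ℝ)
    (hG : G = α • (Q * (Matrix.vecMulVec c c ⊙ F) * Qᵀ))
    (dA : Matrix (Fin n) (Fin n) ℝ) (hdA : dA.IsSymm)
    (S : Matrix (Fin m) (Fin m) ℝ) (hS : Sᵀ = -S)
    (hSe : S.mulVec (Pi.single (⟨0, hm⟩ : Fin m) 1) = 0)
    (N : Matrix (Fin (n - m)) (Fin m) ℝ)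
    (dV : Matrix (Fin n) (Fin m) ℝ) (hdV : dV = V * S + W * N)
    (η : Fin m → ℝ)
    (hη : η = Nᵀ.mulVec (Pi.single (⟨0, Nat.sub_pos_of_lt hmn⟩ : Fin (n - m)) 1))
    (dT : Matrix (Fin m) (Fin m) ℝ)
    (hdT : dT = dVᵀ * A * V + Vᵀ * dA * V + Vᵀ * A * dV)
    (hβ : β = 0) :
    Matrix.trace (Gᵀ * dT) = Matrix.trace (V * G * Vᵀ * dA) := by
  subst hβ
  rw [zero_smul, add_zero] at hLanczos
  have hQ' : Q * Qᵀ = 1 := mul_eq_one_comm.mp hQ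
  have hTs : Tᵀ = T := by
    rw [hT]; simp [Matrix.transpose_mul, Matrix.mul_assoc]
  have hVA : Vᵀ * A = T * Vᵀ := by
    have h := congrArg Matrix.transpose hLanczos
    rw [Matrix.transpose_mul, Matrix.transpose_mul, hA.eq, hTs] at h
    exact h
  have hVW : Vᵀ * W = 0 := by
    have h := congrArg Matrix.transpose hWV
    simpa [Matrix.transpose_mul] using h
  have hVdV : Vᵀ * dV = S := by
    rw [hdV, Matrix.mul_add, ← Matrix.mul_assoc, ← Matrix.mul_assoc, hV, hVW]; simp
  have hdVV : dVᵀ * V = -S := by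
    have h := congrArg Matrix.transpose hVdV
    rw [Matrix.transpose_mul, Matrix.transpose_transpose, hS] at h
    exact h
  have hdT' : dT = Vᵀ * dA * V + (T * S - S * T) := by
    rw [hdT, Matrix.mul_assoc dVᵀ, hLanczos, ← Matrix.mul_assoc dVᵀ, hdVV, hVA,
      Matrix.mul_assoc T, hVdV, Matrix.neg_mul]
    abel
  set M := Matrix.vecMulVec c c ⊙ F with hM
  have hMs : Mᵀ = M := by
    ext i j
    simp only [hM, Matrix.transpose_apply, Matrix.hadamard_apply, Matrix.vecMulVec_apply]
    rw [hFsymm.apply i j]; ring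
  have hGs : Gᵀ = G := by
    rw [hG, Matrix.transpose_smul, Matrix.transpose_mul, Matrix.transpose_mul, hMs,
      Matrix.transpose_transpose, Matrix.mul_assoc]
  set d : Fin m → ℝ := fun i => f (lam i) * c i with hd
  have hcomm : M * Matrix.diagonal lam - Matrix.diagonal lam * M
      = Matrix.vecMulVec c d - Matrix.vecMulVec d c := by
    ext i j
    simp only [Matrix.sub_apply, Matrix.mul_diagonal, Matrix.diagonal_mul, hM,
      Matrix.hadamard_apply, Matrix.vecMulVec_apply, hd]
    linear_combination c i * c j * hF i j
  set e : Fin m → ℝ := Pi.single (⟨0, hm⟩ : Fin m) 1 with he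
  have hQc : Q.mulVec c = e := by
    rw [hc, Matrix.mulVec_mulVec, hQ', Matrix.one_mulVec]
  have hGT : G * T - T * G
      = α • (Matrix.vecMulVec e (Q.mulVec d) - Matrix.vecMulVec (Q.mulVec d) e) := by
    have h1 : G * T = α • (Q * (M * Matrix.diagonal lam) * Qᵀ) := by
      rw [hG, hT, Matrix.smul_mul]
      congr 1
      calc Q * M * Qᵀ * (Q * Matrix.diagonal lam * Qᵀ)
          = Q * M * (Qᵀ * Q) * Matrix.diagonal lam * Qᵀ := by simp only [Matrix.mul_assoc]
        _ = _ := by rw [hQ, Matrix.mul_one]; simp only [Matrix.mul_assoc]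
    have h2 : T * G = α • (Q * (Matrix.diagonal lam * M) * Qᵀ) := by
      rw [hG, hT, Matrix.mul_smul]
      congr 1
      calc Q * Matrix.diagonal lam * Qᵀ * (Q * M * Qᵀ)
          = Q * Matrix.diagonal lam * (Qᵀ * Q) * M * Qᵀ := by simp only [Matrix.mul_assoc]
        _ = _ := by rw [hQ, Matrix.mul_one]; simp only [Matrix.mul_assoc]
    rw [h1, h2, ← smul_sub, ← Matrix.sub_mul, ← Matrix.mul_sub, hcomm, Matrix.mul_sub,
      Matrix.sub_mul, Matrix.mul_vecMulVec, Matrix.mul_vecMulVec, Matrix.vecMulVec_mul,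
      Matrix.vecMulVec_mul, Matrix.vecMul_transpose, Matrix.vecMul_transpose, hQc]
  have heS : Matrix.vecMul e S = 0 := by
    rw [← Matrix.mulVec_transpose, hS, Matrix.neg_mulVec, hSe, neg_zero]
  have hz : Matrix.trace (G * (T * S - S * T)) = 0 := by
    have h1 : Matrix.trace (G * (T * S - S * T)) = Matrix.trace ((G * T - T * G) * S) := by
      rw [Matrix.mul_sub, Matrix.sub_mul, Matrix.trace_sub, Matrix.trace_sub,
        ← Matrix.mul_assoc, ← Matrix.mul_assoc, Matrix.trace_mul_comm (G * S) T,
        Matrix.mul_assoc T G S]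
    rw [h1, hGT, Matrix.smul_mul, Matrix.sub_mul, Matrix.trace_smul, Matrix.trace_sub,
      Matrix.vecMulVec_mul (Q.mulVec d), heS, Matrix.trace_mul_comm, Matrix.mul_vecMulVec, hSe]
    simp
  rw [hGs, hdT', Matrix.mul_add, Matrix.trace_add, hz, add_zero,
    ← Matrix.mul_assoc, Matrix.trace_mul_comm, ← Matrix.mul_assoc, ← Matrix.mul_assoc]
end
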